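/- arXiv:1912.08538 — 3 statements merged into one kernel-verified Lean document; each statement's English description precedes it below -/
import Mathlib

section
/- If R is a convex subalgebra of the set of effects E(S), then the set of meters M_R = { A ∈ M(S) : ran(A) ⊆ R } is simulation closed. -/
open scoped BigOperators

section GPT

variable {V : Type*} [NormedAddCommGroup V] [NormedSpace ℝ V]

/-- A function on a subset `S` is affine if it preserves convex combinations. -/
def IsAffineOn (S : Set V) (f : S → ℝ) : Prop :=
  ∀ (x y : V) (hx : x ∈ S) (hy : y ∈ S) (a b : ℝ), 0 ≤ a → 0 ≤ b → a + b = 1 →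
    ∀ (h : a • x + b • y ∈ S), f ⟨a • x + b • y, h⟩ = a * f ⟨x, hx⟩ + b * f ⟨y, hy⟩

/-- The set of effects on `S`: affine maps `S → ℝ` with values in `[0,1]`. -/
def Effects (S : Set V) : Set (S → ℝ) :=
  {f | IsAffineOn S f ∧ (∀ s, 0 ≤ f s) ∧ (∀ s, f s ≤ 1)}

/-- The unit effect `u`. -/
def unitEff (S : Set V) : S → ℝ := fun _ => 1

/-- A meter: a finite family of effects summing to the unit effect. -/
structure Meter (S : Set V) where
  n : ℕ
  eff : Fin n → S → ℝ
  mem_effects : ∀ x, eff x ∈ Effects S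
  sum_eq : ∑ x, eff x = unitEff S

/-- The range of a meter: all sums of effects over subsets of the outcome set. -/
def Meter.ran {S : Set V} (A : Meter S) : Set (S → ℝ) :=
  {f | ∃ Ω : Finset (Fin A.n), f = ∑ y ∈ Ω, A.eff y}

/-- A post-processing: a row-stochastic matrix. -/
def IsPostProcess {m k : ℕ} (ν : Fin m → Fin k → ℝ) : Prop :=
  (∀ x y, 0 ≤ ν x y) ∧ ∀ x, ∑ y, ν x y = 1

/-- The simulation closure of a set of meters: mixtures of post-processings. -/
def Sim {S : Set V} (ℬ : Set (Meter S)) : Set (Meter S) :=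
  {A | ∃ (m : ℕ) (B : Fin m → Meter S) (p : Fin m → ℝ)
      (ν : (i : Fin m) → Fin (B i).n → Fin A.n → ℝ),
      (∀ i, B i ∈ ℬ) ∧ (∀ i, 0 ≤ p i) ∧ (∑ i, p i = 1) ∧
      (∀ i, IsPostProcess (ν i)) ∧
      (∀ y, A.eff y = ∑ i, p i • ∑ x, ν i x y • (B i).eff x)}

/-- A set of meters is simulation closed if it equals its simulation closure. -/
def SimClosed {S : Set V} (M' : Set (Meter S)) : Prop := Sim M' = M'

/-- The meters whose range is contained in a given set of effects. -/
def MetersOf {S : Set V} (R : Set (S → ℝ)) : Set (Meter S) :=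
  {A | A.ran ⊆ R}

/-- The effects arising in the range of some meter in a given set of meters. -/
def EffectsOf {S : Set V} (M' : Set (Meter S)) : Set (S → ℝ) :=
  {e | e ∈ Effects S ∧ ∃ A ∈ M', e ∈ A.ran}

/-- Consistency condition (E1): the unit effect is available. -/
def CondE1 (S : Set V) (R : Set (S → ℝ)) : Prop := unitEff S ∈ R

/-- Consistency condition (E2): every available effect occurs in some available meter. -/
def CondE2 (S : Set V) (R : Set (S → ℝ)) : Prop :=
  ∀ e ∈ R, ∃ A ∈ MetersOf R, e ∈ A.ran

/-- The largest value of an effect on the state space. -/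
noncomputable def lmax {S : Set V} (f : S → ℝ) : ℝ := ⨆ s, f s

/-- The smallest value of an effect on the state space. -/
noncomputable def lmin {S : Set V} (f : S → ℝ) : ℝ := ⨅ s, f s

/-- Effectively `n`-tomic meters: the simulation closure of meters with at most
`n` outcomes. -/
def MEff (S : Set V) (n : ℕ) : Set (Meter S) := Sim {A : Meter S | A.n ≤ n}

/-- A convex subalgebra of the set of effects. -/
def IsConvexSubalgebra (S : Set V) (R : Set (S → ℝ)) : Prop :=
  R ⊆ Effects S ∧ unitEff S ∈ R ∧
  (∀ e ∈ R, unitEff S - e ∈ R) ∧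
  (∀ e ∈ R, ∀ f ∈ R, e + f ∈ Effects S → e + f ∈ R) ∧
  (∀ a : ℝ, a ∈ Set.Icc (0:ℝ) 1 → ∀ e ∈ R, a • e ∈ R)

/-- Two meters are compatible if both can be simulated from a single meter. -/
def Compatible {S : Set V} (A B : Meter S) : Prop :=
  ∃ C : Meter S, A ∈ Sim {C} ∧ B ∈ Sim {C}

/-- The set of meters compatible with a given meter. -/
def CompatSet {S : Set V} (A : Meter S) : Set (Meter S) :=
  {B | Compatible A B}

/-- The noise content of a meter with respect to trivial meters. -/
noncomputable def noiseContent {S : Set V} (B : Meter S) : ℝ :=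
  sSup {l : ℝ | l ∈ Set.Icc (0:ℝ) 1 ∧
    ∃ (p : Fin B.n → ℝ) (Ceff : Fin B.n → S → ℝ),
      (∀ x, 0 ≤ p x) ∧ (∑ x, p x = 1) ∧
      (∀ x, Ceff x ∈ Effects S) ∧ (∑ x, Ceff x = unitEff S) ∧
      ∀ x, B.eff x = l • (p x • unitEff S) + (1 - l) • Ceff x}

/-- The set `R_t` of meters that are `t`-noisy versions of some meter with the
same outcome set. -/
def Rt (S : Set V) (t : ℝ) : Set (Meter S) :=
  {A | ∃ (Beff : Fin A.n → S → ℝ) (p : Fin A.n → ℝ),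
      (∀ x, Beff x ∈ Effects S) ∧ (∑ x, Beff x = unitEff S) ∧
      (∀ x, 0 ≤ p x) ∧ (∑ x, p x = 1) ∧
      ∀ x, A.eff x = t • Beff x + ((1 - t) * p x) • unitEff S}

end GPT
namespace IsConvexSubalgebra

variable {V : Type*} [NormedAddCommGroup V] [NormedSpace ℝ V] {S : Set V} {R : Set (S → ℝ)}

theorem add_mem_of_le_one (hR : IsConvexSubalgebra S R) {e f : S → ℝ} (he : e ∈ R) (hf : f ∈ R)
    (h : ∀ s, e s + f s ≤ 1) : e + f ∈ R := by
  refine hR.2.2.2.1 e he f hf ⟨?_, fun s => ?_, h⟩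
  · intro x y hx hy a b ha hb hab hxy
    simp only [Pi.add_apply]
    rw [(hR.1 he).1 x y hx hy a b ha hb hab hxy, (hR.1 hf).1 x y hx hy a b ha hb hab hxy]
    ring
  · exact add_nonneg ((hR.1 he).2.1 s) ((hR.1 hf).2.1 s)

theorem zero_mem (hR : IsConvexSubalgebra S R) : (0 : S → ℝ) ∈ R := by
  simpa using hR.2.2.1 _ hR.2.1

theorem sum_mem_of_le_one (hR : IsConvexSubalgebra S R) {ι : Type*} (t : Finset ι)
    (g : ι → S → ℝ) (hg : ∀ i ∈ t, g i ∈ R) (h : ∀ s, ∑ i ∈ t, g i s ≤ 1) :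
    ∑ i ∈ t, g i ∈ R := by
  classical
  induction t using Finset.induction_on with
  | empty => simpa using hR.zero_mem
  | insert a t ha ih =>
    have hga := hg a (Finset.mem_insert_self a t)
    rw [Finset.sum_insert ha]
    refine hR.add_mem_of_le_one hga
      (ih (fun i hi => hg i (Finset.mem_insert_of_mem hi)) fun s => ?_) fun s => ?_
    · have hs := h s
      rw [Finset.sum_insert ha] at hs
      linarith [(hR.1 hga).2.1 s]
    · simpa [Finset.sum_insert ha] using h s

/-- Weighted sums of the effects of a meter, with weights in `[0, 1]`, stay in the subalgebra. -/
theorem sum_smul_eff_mem (hR : IsConvexSubalgebra S R) {B : Meter S} (hB : B ∈ MetersOf R)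
    (c : Fin B.n → ℝ) (hc : ∀ x, c x ∈ Set.Icc (0 : ℝ) 1) : ∑ x, c x • B.eff x ∈ R := by
  refine hR.sum_mem_of_le_one _ _ (fun x _ => ?_) fun s => ?_
  · exact hR.2.2.2.2 _ (hc x) _ (hB ⟨{x}, by simp⟩)
  · calc ∑ x, (c x • B.eff x) s ≤ ∑ x, B.eff x s := Finset.sum_le_sum fun x _ =>
          mul_le_of_le_one_left ((B.mem_effects x).2.1 s) (hc x).2
      _ = 1 := by simpa [unitEff] using congrFun B.sum_eq s

theorem convexCombination_mem (hR : IsConvexSubalgebra S R) {m : ℕ} (p : Fin m → ℝ)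
    (hp : ∀ i, 0 ≤ p i) (hp1 : ∑ i, p i = 1) (g : Fin m → S → ℝ) (hg : ∀ i, g i ∈ R) :
    ∑ i, p i • g i ∈ R := by
  refine hR.sum_mem_of_le_one _ _ (fun i _ => ?_) fun s => ?_
  · refine hR.2.2.2.2 _ ⟨hp i, ?_⟩ _ (hg i)
    exact hp1 ▸ Finset.single_le_sum (fun j _ => hp j) (Finset.mem_univ i)
  · calc ∑ i, (p i • g i) s ≤ ∑ i, p i := Finset.sum_le_sum fun i _ =>
          mul_le_of_le_one_right (hp i) ((hR.1 (hg i)).2.2 s)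
      _ = 1 := hp1

end IsConvexSubalgebra

theorem subset_sim {V : Type*} [NormedAddCommGroup V] [NormedSpace ℝ V] {S : Set V}
    (ℬ : Set (Meter S)) : ℬ ⊆ Sim ℬ := by
  intro A hA
  refine ⟨1, fun _ => A, fun _ => 1, fun _ x y => if x = y then 1 else 0, fun _ => hA,
    fun _ => zero_le_one, by simp, fun _ => ⟨fun x y => ?_, fun x => by simp⟩, fun y => by simp⟩
  dsimp only
  split_ifs <;> norm_num

/-- If `R` is a convex subalgebra of `E(S)`, then `M_R` is
simulation closed. -/
theorem metersOf_simClosed_of_convexSubalgebra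
    {V : Type*} [NormedAddCommGroup V] [NormedSpace ℝ V] [FiniteDimensional ℝ V]
    {S : Set V} (hne : S.Nonempty) (hcomp : IsCompact S) (hconv : Convex ℝ S)
    (R : Set (S → ℝ)) (hR : IsConvexSubalgebra S R) :
    SimClosed (MetersOf R) := by
  refine Set.Subset.antisymm ?_ (subset_sim _)
  rintro A ⟨m, B, p, ν, hB, hp, hp1, hν, hA⟩ _ ⟨Ω, rfl⟩
  have key : ∑ y ∈ Ω, A.eff y =
      ∑ i, p i • ∑ x, (∑ y ∈ Ω, ν i x y) • (B i).eff x := by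
    simp_rw [hA, Finset.sum_smul]
    rw [Finset.sum_comm]
    refine Finset.sum_congr rfl fun i _ => ?_
    rw [← Finset.smul_sum, Finset.sum_comm]
  rw [key]
  refine hR.convexCombination_mem p hp hp1 _ fun i => hR.sum_smul_eff_mem (hB i) _ fun x => ?_
  refine ⟨Finset.sum_nonneg fun y _ => (hν i).1 x y, ?_⟩
  rw [← (hν i).2 x]
  exact Finset.sum_le_sum_of_subset_of_nonneg (Finset.subset_univ Ω) fun y _ _ => (hν i).1 x y
end

section
/- Let A be a meter with n outcomes whose effects A_1, …, A_n are linearly independent in the vector space of affine maps S → ℝ, and let E' = { e ∈ E(S) : e = Σ_{x=1}^n r_x A_x for some r_1, …, r_n ∈ [0,1] }. Then E' is a convex subalgebra of E(S) if and only if λ_max(A_x) = 1 for every x ∈ {1, …, n}. -/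
open scoped BigOperators

section GPT

variable {V : Type*} [NormedAddCommGroup V] [NormedSpace ℝ V] {S : Set V}

theorem unitEff_mem_Effects : unitEff S ∈ Effects S := by
  refine ⟨fun x y hx hy a b _ _ hab h => ?_, fun _ => zero_le_one, fun _ => le_rfl⟩
  simp [unitEff, hab]

theorem unitEff_sub_mem_Effects {e : S → ℝ} (he : e ∈ Effects S) :
    unitEff S - e ∈ Effects S := by
  refine ⟨fun x y hx hy a b ha hb hab h => ?_, fun s => ?_, fun s => ?_⟩
  · simp only [unitEff, Pi.sub_apply, he.1 x y hx hy a b ha hb hab h]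
    linear_combination -hab
  · simpa [unitEff] using he.2.2 s
  · simpa [unitEff] using he.2.1 s

theorem smul_mem_Effects {e : S → ℝ} (he : e ∈ Effects S) {c : ℝ} (hc : 0 ≤ c)
    (hle : ∀ s, c * e s ≤ 1) : c • e ∈ Effects S := by
  refine ⟨fun x y hx hy a b ha hb hab h => ?_, fun s => mul_nonneg hc (he.2.1 s), hle⟩
  simp only [Pi.smul_apply, smul_eq_mul, he.1 x y hx hy a b ha hb hab h]
  ring

theorem le_lmax {e : S → ℝ} (he : e ∈ Effects S) (s : S) : e s ≤ lmax e :=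
  le_ciSup (f := e) ⟨1, by rintro _ ⟨t, rfl⟩; exact he.2.2 t⟩ s

theorem lmax_le_one (hne : S.Nonempty) {e : S → ℝ} (he : e ∈ Effects S) : lmax e ≤ 1 :=
  have := hne.to_subtype
  ciSup_le he.2.2

theorem Meter.sum_eff_apply (A : Meter S) (s : S) : ∑ x, A.eff x s = 1 := by
  simpa [unitEff] using congrFun A.sum_eq s

theorem Meter.sum_one_sub_smul_eff (A : Meter S) (r : Fin A.n → ℝ) :
    ∑ x, (1 - r x) • A.eff x = unitEff S - ∑ x, r x • A.eff x := by
  simp [sub_smul, Finset.sum_sub_distrib, A.sum_eq]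

/-- A coefficient of a nonnegative linear combination of the effects of a meter is nonnegative
if the corresponding effect has maximal value `1`. -/
theorem Meter.coeff_nonneg (hne : S.Nonempty) (A : Meter S) {x : Fin A.n}
    (hx : lmax (A.eff x) = 1) {r : Fin A.n → ℝ} (hr : ∀ s, 0 ≤ (∑ y, r y • A.eff y) s) :
    0 ≤ r x := by
  have := hne.to_subtype
  by_contra! hneg
  set C : ℝ := ∑ y, |r y|
  have hC : ∀ y, r y ≤ C := fun y => (le_abs_self _).trans
    (Finset.single_le_sum (f := fun y => |r y|) (fun _ _ => abs_nonneg _) (Finset.mem_univ y))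
  have hC0 : 0 ≤ C := Finset.sum_nonneg fun _ _ => abs_nonneg _
  have hpos : 0 < C - r x := by linarith
  have hbound : ∀ s, A.eff x s ≤ C / (C - r x) := fun s => by
    have hsingle : (C - r x) * A.eff x s ≤ ∑ y, (C - r y) * A.eff y s :=
      Finset.single_le_sum (f := fun y => (C - r y) * A.eff y s)
        (fun y _ => mul_nonneg (sub_nonneg.2 (hC y)) ((A.mem_effects y).2.1 s))
        (Finset.mem_univ x)
    have hs := hr s
    simp only [Finset.sum_apply, Pi.smul_apply, smul_eq_mul] at hs
    simp only [sub_mul, Finset.sum_sub_distrib, ← Finset.mul_sum, A.sum_eff_apply] at hsingle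
    rw [le_div_iff₀ hpos]
    linarith
  have hle : lmax (A.eff x) ≤ C / (C - r x) := ciSup_le hbound
  rw [hx, le_div_iff₀ hpos] at hle
  linarith

theorem Meter.coeff_mem_Icc (hne : S.Nonempty) (A : Meter S) {x : Fin A.n}
    (hx : lmax (A.eff x) = 1) {r : Fin A.n → ℝ} (hr : ∑ y, r y • A.eff y ∈ Effects S) :
    r x ∈ Set.Icc (0 : ℝ) 1 := by
  refine ⟨A.coeff_nonneg hne hx hr.2.1, sub_nonneg.1 ?_⟩
  refine A.coeff_nonneg hne hx (r := fun y => 1 - r y) ?_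
  rw [A.sum_one_sub_smul_eff]
  exact (unitEff_sub_mem_Effects hr).2.1

end GPT

/-- For a meter `A` with linearly independent effects, the set
`E' = { ∑ r_x A_x : r_x ∈ [0,1] } ∩ E(S)` is a convex subalgebra of `E(S)` iff
`λ_max(A_x) = 1` for every outcome `x`. -/
theorem sim_singleton_effects_convexSubalgebra_iff
    {V : Type*} [NormedAddCommGroup V] [NormedSpace ℝ V] [FiniteDimensional ℝ V]
    {S : Set V} (hne : S.Nonempty) (hcomp : IsCompact S) (hconv : Convex ℝ S)
    (A : Meter S) (hli : LinearIndependent ℝ A.eff) :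
    IsConvexSubalgebra S {e | e ∈ Effects S ∧
      ∃ r : Fin A.n → ℝ, (∀ x, r x ∈ Set.Icc (0:ℝ) 1) ∧ e = ∑ x, r x • A.eff x}
    ↔ ∀ x, lmax (A.eff x) = 1 := by
  constructor
  · rintro ⟨-, -, -, hadd, -⟩ x
    refine (lmax_le_one hne (A.mem_effects x)).antisymm (not_lt.1 fun hlt => ?_)
    set m := lmax (A.eff x)
    obtain ⟨s₀, hs₀⟩ := hne
    have hm : 0 ≤ m := ((A.mem_effects x).2.1 ⟨s₀, hs₀⟩).trans (le_lmax (A.mem_effects x) _)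
    have hpos : 0 < 1 + m := by linarith
    set d : ℝ := (1 + m)⁻¹
    have hd : d * (1 + m) = 1 := inv_mul_cancel₀ hpos.ne'
    have hd0 : 0 < d := inv_pos.2 hpos
    have hd1 : d ≤ 1 := by nlinarith
    have hscaled : ∀ s, d * A.eff x s ≤ d * m := fun s =>
      mul_le_mul_of_nonneg_left (le_lmax (A.mem_effects x) s) hd0.le
    have hdm : d * m < d := by nlinarith
    have hhalf : d • A.eff x ∈ {e | e ∈ Effects S ∧
        ∃ r : Fin A.n → ℝ, (∀ x, r x ∈ Set.Icc (0:ℝ) 1) ∧ e = ∑ x, r x • A.eff x} := by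
      refine ⟨smul_mem_Effects (A.mem_effects x) hd0.le fun s => by linarith [hscaled s],
        Pi.single x d, fun y => ?_, ?_⟩
      · obtain rfl | hy := eq_or_ne y x
        · simpa using ⟨hd0.le, hd1⟩
        · simp [hy]
      · simp [Pi.single_apply, ite_smul]
    have hdouble : d • A.eff x + d • A.eff x ∈ Effects S := by
      rw [← add_smul]
      refine smul_mem_Effects (A.mem_effects x) (by linarith) fun s => ?_
      linarith [hscaled s]
    obtain ⟨-, r, hr, heq⟩ := hadd _ hhalf _ hhalf hdouble
    have hsingle : ∑ y, (Pi.single x (d + d) : Fin A.n → ℝ) y • A.eff y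
        = ∑ y, r y • A.eff y := by
      rw [← heq]
      simp [Pi.single_apply, ite_smul, add_smul]
    have hrx := Fintype.linearIndependent_iffₛ.1 hli _ _ hsingle x
    rw [Pi.single_eq_same] at hrx
    linarith [(hr x).2]
  · intro hmax
    have hmem : ∀ {e : S → ℝ}, e ∈ Effects S → ∀ r : Fin A.n → ℝ, e = ∑ x, r x • A.eff x →
        e ∈ {e | e ∈ Effects S ∧
          ∃ r : Fin A.n → ℝ, (∀ x, r x ∈ Set.Icc (0:ℝ) 1) ∧ e = ∑ x, r x • A.eff x} :=
      fun he r h => ⟨he, r, fun x => A.coeff_mem_Icc hne (hmax x) (h ▸ he), h⟩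
    refine ⟨fun e he => he.1, hmem unitEff_mem_Effects (fun _ => 1) ?_, ?_, ?_, ?_⟩
    · simp [A.sum_eq]
    · rintro e ⟨he, r, -, rfl⟩
      exact hmem (unitEff_sub_mem_Effects he) _ (A.sum_one_sub_smul_eff r).symm
    · rintro e ⟨-, r, -, rfl⟩ f ⟨-, t, -, rfl⟩ hef
      exact hmem hef (r + t) (by simp [add_smul, Finset.sum_add_distrib])
    · rintro a ha e ⟨he, r, -, rfl⟩
      exact hmem (smul_mem_Effects he ha.1 fun s => mul_le_one₀ ha.2 (he.2.1 s) (he.2.2 s))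
        (a • r) (by simp [Finset.smul_sum, mul_smul])
end

section
/- For every t ∈ [0,1], the set R_t = { A ∈ M(S) : A_x = t B_x + (1−t) p_x u for all x ∈ Ω_A, for some meter B with Ω_B = Ω_A and probability distribution p on Ω_A } is simulation closed: sim(R_t) = R_t. -/
open scoped BigOperators

theorem sum_mixture_postProcess {M : Type*} [AddCommGroup M] [Module ℝ M] {m k : ℕ}
    {n : Fin m → ℕ} {p : Fin m → ℝ} {ν : (i : Fin m) → Fin (n i) → Fin k → ℝ}
    {F : (i : Fin m) → Fin (n i) → M} {u : M} (hp : ∑ i, p i = 1)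
    (hν : ∀ i, IsPostProcess (ν i)) (hF : ∀ i, ∑ x, F i x = u) :
    ∑ y, ∑ i, p i • ∑ x, ν i x y • F i x = u := by
  rw [Finset.sum_comm]
  have h : ∀ i, ∑ y, p i • ∑ x, ν i x y • F i x = p i • u := by
    intro i
    rw [← Finset.smul_sum, Finset.sum_comm]
    simp_rw [← Finset.sum_smul, (hν i).2, one_smul, hF i]
  simp_rw [h, ← Finset.sum_smul, hp, one_smul]

section Affine

variable {V : Type*} [NormedAddCommGroup V] [NormedSpace ℝ V] {S : Set V}

theorem IsAffineOn.const_smul {f : S → ℝ} (hf : IsAffineOn S f) (c : ℝ) :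
    IsAffineOn S (c • f) := by
  intro x y hx hy a b ha hb hab h
  simp only [Pi.smul_apply, smul_eq_mul, hf x y hx hy a b ha hb hab h]
  ring

theorem IsAffineOn.sum {ι : Type*} {s : Finset ι} {f : ι → S → ℝ}
    (hf : ∀ i, IsAffineOn S (f i)) : IsAffineOn S (∑ i ∈ s, f i) := by
  intro x y hx hy a b ha hb hab h
  simp only [Finset.sum_apply, Finset.mul_sum, ← Finset.sum_add_distrib]
  exact Finset.sum_congr rfl fun i _ => hf i x y hx hy a b ha hb hab h

theorem mem_Effects_of_sum_eq_unitEff {ι : Type*} [Fintype ι] {f : ι → S → ℝ}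
    (haff : ∀ i, IsAffineOn S (f i)) (hnonneg : ∀ i s, 0 ≤ f i s)
    (hsum : ∑ i, f i = unitEff S) (i : ι) : f i ∈ Effects S := by
  refine ⟨haff i, hnonneg i, fun s => ?_⟩
  have h : ∑ j, f j s = 1 := by rw [← Finset.sum_apply, hsum]; rfl
  exact h ▸ Finset.single_le_sum (f := fun j => f j s) (fun j _ => hnonneg j s)
    (Finset.mem_univ i)

theorem subset_Sim (ℬ : Set (Meter S)) : ℬ ⊆ Sim ℬ := by
  intro A hA
  refine ⟨1, fun _ => A, fun _ => 1, fun _ x y => if x = y then 1 else 0,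
    fun _ => hA, fun _ => zero_le_one, by simp, fun _ => ⟨fun x y => ?_, fun x => by simp⟩,
    fun y => by simp⟩
  dsimp only
  split_ifs <;> norm_num

theorem Sim_Rt_subset (t : ℝ) : Sim (Rt S t) ⊆ Rt S t := by
  rintro A ⟨m, B, p, ν, hB, hp, hp1, hν, hA⟩
  choose F q hF hF1 hq hq1 hBF using hB
  have hsum := sum_mixture_postProcess hp1 hν hF1
  refine ⟨fun y => ∑ i, p i • ∑ x, ν i x y • F i x,
    fun y => ∑ i, p i • ∑ x, ν i x y • q i x,
    mem_Effects_of_sum_eq_unitEff (fun y => ?_) (fun y s => ?_) hsum, hsum, fun y => ?_,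
    sum_mixture_postProcess hp1 hν hq1, fun y => ?_⟩
  · exact IsAffineOn.sum fun i =>
      (IsAffineOn.sum fun x => (hF i x).1.const_smul _).const_smul _
  · simp only [Finset.sum_apply, Pi.smul_apply, smul_eq_mul]
    exact Finset.sum_nonneg fun i _ => mul_nonneg (hp i) <| Finset.sum_nonneg fun x _ =>
      mul_nonneg ((hν i).1 x y) ((hF i x).2.1 s)
  · exact Finset.sum_nonneg fun i _ => mul_nonneg (hp i) <| Finset.sum_nonneg fun x _ =>
      mul_nonneg ((hν i).1 x y) (hq i x)
  · rw [hA y]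
    ext s
    simp only [hBF, Finset.sum_apply, Pi.smul_apply, Pi.add_apply, smul_eq_mul, unitEff,
      mul_one, Finset.mul_sum, ← Finset.sum_add_distrib]
    exact Finset.sum_congr rfl fun i _ => Finset.sum_congr rfl fun x _ => by ring

end Affine

/-- For every `t ∈ [0,1]`, the set `R_t` of `t`-noisy meters is
simulation closed. -/
theorem Rt_simClosed
    {V : Type*} [NormedAddCommGroup V] [NormedSpace ℝ V] [FiniteDimensional ℝ V]
    {S : Set V} (hne : S.Nonempty) (hcomp : IsCompact S) (hconv : Convex ℝ S)
    (t : ℝ) (ht : t ∈ Set.Icc (0:ℝ) 1) :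
    Sim (Rt S t) = Rt S t :=
  (Sim_Rt_subset t).antisymm (subset_Sim _)
end
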